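/- Let K be a field and let a, b, c, d, e, f be vectors in K^4. If [a b c e]·[a b d f]·[c e d f] = 0 and [a b c f]·[a b d e]·[c f d e] = 0, then [a b c d]·[a b e f]·[c d e f] = 0. (Equivalently: if the lines ab, ce, df are not mutually skew and the lines ab, cf, de are not mutually skew, then the lines ab, cd, ef are not mutually skew.) -/

import Mathlib

/-- The bracket `[a b c d]`: determinant of the 4×4 matrix with columns
(equivalently rows) `a`, `b`, `c`, `d`. -/
def br {K : Type*} [CommRing K] (a b c d : Fin 4 → K) : K :=
  (Matrix.of ![a, b, c, d]).det

theorem br_eq {K : Type*} [CommRing K] (a b c d : Fin 4 → K) :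
    br a b c d =
      (a 0 * b 1 - a 1 * b 0) * (c 2 * d 3 - c 3 * d 2)
        - (a 0 * b 2 - a 2 * b 0) * (c 1 * d 3 - c 3 * d 1)
        + (a 0 * b 3 - a 3 * b 0) * (c 1 * d 2 - c 2 * d 1)
        + (a 1 * b 2 - a 2 * b 1) * (c 0 * d 3 - c 3 * d 0)
        - (a 1 * b 3 - a 3 * b 1) * (c 0 * d 2 - c 2 * d 0)
        + (a 2 * b 3 - a 3 * b 2) * (c 0 * d 1 - c 1 * d 0) := by
  simp [br, Matrix.det_succ_row_zero, Fin.sum_univ_succ, Fin.succAbove]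
  ring

/-- The three-term Grassmann–Plücker relation. -/
theorem br_three_term {K : Type*} [CommRing K] (a b c d e f : Fin 4 → K) :
    br a b c d * br a b e f - br a b c e * br a b d f + br a b c f * br a b d e = 0 := by
  simp only [br_eq]
  ring

theorem br_swap_middle {K : Type*} [CommRing K] (a b c d : Fin 4 → K) :
    br a c b d = -br a b c d := by
  simp only [br_eq]
  ring

theorem br_swap_right {K : Type*} [CommRing K] (a b c d : Fin 4 → K) :
    br a b d c = -br a b c d := by
  simp only [br_eq]
  ring

/-- Lemma 5.3, first assertion: if the lines `ab`, `ce`, `df` are not mutually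
skew and the lines `ab`, `cf`, `de` are not mutually skew, then the lines
`ab`, `cd`, `ef` are not mutually skew. -/
theorem not_skew_of_not_skew {K : Type*} [Field K] (a b c d e f : Fin 4 → K)
    (h1 : br a b c e * br a b d f * br c e d f = 0)
    (h2 : br a b c f * br a b d e * br c f d e = 0) :
    br a b c d * br a b e f * br c d e f = 0 := by
  rw [br_swap_middle c d e f] at h1
  rw [br_swap_middle c d f e, br_swap_right c d e f, neg_neg] at h2
  linear_combination br c d e f * br_three_term a b c d e f - h1 - h2
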